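/- arXiv:1505.07676 — 4 statements merged into one kernel-verified Lean document; each statement's English description precedes it below -/
import Mathlib

section
/- Let x₁, …, xₙ ∈ ℝ^k, let D be the n×n matrix with entries D_{ij} = ‖x_i − x_j‖², and let H = I − (1/n)𝟙𝟙ᵀ. Then the matrix B = −(1/2) H D H is symmetric positive semi-definite and has rank at most k. -/
open Matrix

/-- The centering matrix annihilates the all-ones vector. -/
theorem centering_mulVec_one {n : ℕ} (hn : 0 < n) :
    ((1 : Matrix (Fin n) (Fin n) ℝ) - (n : ℝ)⁻¹ • Matrix.of (fun _ _ => (1 : ℝ))) *ᵥ 1 = 0 := by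
  have hn_ne : (n : ℝ) ≠ 0 := by positivity
  ext i
  rw [sub_mulVec, one_mulVec]
  simp [mulVec, dotProduct, hn_ne]

/-- The centering matrix is symmetric. -/
theorem transpose_centering (n : ℕ) :
    ((1 : Matrix (Fin n) (Fin n) ℝ) - (n : ℝ)⁻¹ • Matrix.of (fun _ _ => (1 : ℝ)))ᵀ =
      1 - (n : ℝ)⁻¹ • Matrix.of (fun _ _ => (1 : ℝ)) := by
  ext i j
  simp [one_apply, eq_comm]

/-- A squared distance matrix is a sum of two rank-one terms and a multiple of the Gram matrix. -/
theorem sq_dist_eq_vecMulVec_sub_gram {m l : Type*} [Fintype l] (X : Matrix m l ℝ) :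
    Matrix.of (fun i j => ∑ a, (X i a - X j a) ^ 2) =
      vecMulVec (fun i => ∑ a, X i a ^ 2) 1 + vecMulVec 1 (fun i => ∑ a, X i a ^ 2) -
        (2 : ℝ) • (X * Xᵀ) := by
  ext i j
  simp only [of_apply, Matrix.add_apply, Matrix.sub_apply, Matrix.smul_apply,
    vecMulVec_apply, mul_apply, transpose_apply, Pi.one_apply, mul_one, one_mul, smul_eq_mul,
    Finset.mul_sum]
  rw [← Finset.sum_add_distrib, ← Finset.sum_sub_distrib]
  exact Finset.sum_congr rfl fun a _ => by ring

/-- Double centering a squared distance matrix gives the Gram matrix of the centered points. -/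
theorem double_centering_eq_gram {m l : Type*} [Fintype m] [Fintype l] (X : Matrix m l ℝ)
    {H : Matrix m m ℝ} (hsymm : Hᵀ = H) (hone : H *ᵥ 1 = 0) :
    (-(1 / 2 : ℝ)) • (H * Matrix.of (fun i j => ∑ a, (X i a - X j a) ^ 2) * H) =
      (H * X) * (H * X)ᵀ := by
  have one_vecMul_eq : 1 ᵥ* H = 0 := by rw [← hsymm, vecMul_transpose, hone]
  rw [sq_dist_eq_vecMulVec_sub_gram, Matrix.mul_sub, Matrix.mul_add, mul_vecMulVec,
    mul_vecMulVec, hone, Matrix.sub_mul, Matrix.add_mul, vecMulVec_mul, one_vecMul_eq]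
  simp [smul_smul, transpose_mul, hsymm, Matrix.mul_assoc]

/-- If `D` is the squared Euclidean distance matrix of points `x₁,…,xₙ ∈ ℝ^k`
(the rows of `X`) and `H = I − (1/n)𝟙𝟙ᵀ`, then `B = −(1/2) H D H` is symmetric
positive semi-definite of rank at most `k`. -/
theorem double_centering_psd_rank (n k : ℕ) (hn : 0 < n)
    (X : Matrix (Fin n) (Fin k) ℝ)
    (D : Matrix (Fin n) (Fin n) ℝ)
    (hD : ∀ i j, D i j = ∑ l, (X i l - X j l) ^ 2)
    (H B : Matrix (Fin n) (Fin n) ℝ)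
    (hH : H = 1 - (n : ℝ)⁻¹ • Matrix.of (fun _ _ => (1 : ℝ)))
    (hB : B = (-(1 / 2 : ℝ)) • (H * D * H)) :
    Bᵀ = B ∧ B.PosSemidef ∧ B.rank ≤ k := by
  have hgram : B = (H * X) * (H * X)ᵀ := by
    have hDX : D = Matrix.of (fun i j => ∑ a, (X i a - X j a) ^ 2) := by
      ext i j
      exact hD i j
    rw [hB, hDX]
    subst hH
    exact double_centering_eq_gram X (transpose_centering n) (centering_mulVec_one hn)
  rw [hgram]
  refine ⟨by simp, ?_, (rank_mul_le_left _ _).trans (rank_le_width _)⟩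
  simpa using posSemidef_self_mul_conjTranspose (H * X)
end

section
/- Let D be an n×n real symmetric matrix with zero diagonal, let H = I − (1/n)𝟙𝟙ᵀ, and let B = −(1/2) H D H. Then dist(B) = D, i.e. for all i, j, b_{ii} + b_{jj} − 2 b_{ij} = D_{ij}. Thus double centering followed by the dist map is the identity on symmetric hollow matrices. -/
open Matrix

/-- The entries of `(1 - c𝟙𝟙ᵀ) D (1 - c𝟙𝟙ᵀ)` in terms of row, column and total sums of `D`. -/
theorem Matrix.one_sub_smul_ones_mul_mul_apply {ι R : Type*} [Fintype ι] [DecidableEq ι]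
    [CommRing R] (c : R) (D : Matrix ι ι R) (i j : ι) :
    ((1 - c • Matrix.of (fun _ _ => (1 : R))) * D *
      (1 - c • Matrix.of (fun _ _ => (1 : R))) : Matrix ι ι R) i j =
      D i j - c * ∑ k, D k j - c * ∑ k, D i k + c ^ 2 * ∑ k, ∑ l, D l k := by
  have hleft (k : ι) : ((1 - c • Matrix.of (fun _ _ => (1 : R))) * D : Matrix ι ι R) i k =
      D i k - c * ∑ l, D l k := by
    rw [sub_mul, one_mul, smul_mul_assoc, Matrix.sub_apply, Matrix.smul_apply, Matrix.mul_apply]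
    simp
  rw [mul_sub, mul_one, mul_smul_comm, Matrix.sub_apply, Matrix.smul_apply, hleft,
    Matrix.mul_apply]
  simp only [hleft, Matrix.of_apply, mul_one, Finset.sum_sub_distrib, ← Finset.mul_sum,
    smul_eq_mul]
  ring

/-- For a symmetric hollow matrix `D` (zero diagonal), double centering followed by the
`dist` map is the identity: with `H = I − (1/n)𝟙𝟙ᵀ` and `B = −(1/2) H D H`, one has
`b_{ii} + b_{jj} − 2 b_{ij} = D_{ij}` for all `i, j`. -/
theorem dist_of_double_centering (n : ℕ) (hn : 0 < n)
    (D : Matrix (Fin n) (Fin n) ℝ)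
    (hsymm : Dᵀ = D) (hdiag : ∀ i, D i i = 0)
    (H B : Matrix (Fin n) (Fin n) ℝ)
    (hH : H = 1 - (n : ℝ)⁻¹ • Matrix.of (fun _ _ => (1 : ℝ)))
    (hB : B = (-(1 / 2 : ℝ)) • (H * D * H)) :
    ∀ i j, B i i + B j j - 2 * B i j = D i j := by
  intro i j
  have hsum (a : Fin n) : ∑ k, D k a = ∑ k, D a k :=
    Finset.sum_congr rfl fun k _ => congrFun₂ hsymm a k
  subst hB hH
  simp only [Matrix.smul_apply, Matrix.one_sub_smul_ones_mul_mul_apply, hsum, hdiag, smul_eq_mul]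
  ring
end

section
/- Let D be an n×n real symmetric matrix with zero diagonal, let H = I − (1/n)𝟙𝟙ᵀ, and suppose that B = −(1/2) H D H is positive semi-definite with rank(B) ≤ k. Then there exist points x₁, …, xₙ ∈ ℝ^k such that D_{ij} = ‖x_i − x_j‖² for all i, j; namely, writing B = XXᵀ for some X ∈ ℝ^{n×k}, the rows of X provide such a configuration. -/
open Matrix

/-- A real positive semi-definite matrix of rank at most `card κ` is a Gram matrix of vectors
indexed by `κ`. -/
theorem exists_eq_mul_transpose_of_rank_le {ι κ : Type*} [Fintype ι] [DecidableEq ι] [Fintype κ]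
    {B : Matrix ι ι ℝ} (hB : B.PosSemidef) (hrank : B.rank ≤ Fintype.card κ) :
    ∃ X : Matrix ι κ ℝ, B = X * Xᵀ := by
  classical
  have hH := hB.isHermitian
  rw [hH.rank_eq_card_non_zero_eigs] at hrank
  obtain ⟨e⟩ := Function.Embedding.nonempty_of_card_le hrank
  let U : Matrix ι ι ℝ := hH.eigenvectorUnitary
  let f (i : ι) (m : {m // hH.eigenvalues m ≠ 0}) : ℝ := √(hH.eigenvalues m) * U i m
  refine ⟨of fun i => Function.extend e (f i) 0, ?_⟩
  ext i j
  have hentry : B i j = ∑ m, hH.eigenvalues m * (U i m * U j m) := by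
    conv_lhs => rw [hH.spectral_theorem, Unitary.conjStarAlgAut_apply]
    rw [mul_apply]
    refine Finset.sum_congr rfl fun m _ => ?_
    simp [mul_diagonal, U, star_apply]
    ring
  rw [hentry, mul_apply]
  have hzero : ∀ l, l ∉ Set.range e →
      Function.extend e (f i) 0 l * Function.extend e (f j) 0 l = 0 := by
    intro l hl
    rw [Function.extend_apply' _ _ _ hl, Pi.zero_apply, zero_mul]
  calc ∑ m, hH.eigenvalues m * (U i m * U j m)
      = ∑ m : {m // hH.eigenvalues m ≠ 0}, hH.eigenvalues m * (U i m * U j m) := by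
        rw [← Finset.sum_subtype (Finset.univ.filter fun m => hH.eigenvalues m ≠ 0) (by simp)
          fun m => hH.eigenvalues m * (U i m * U j m)]
        exact (Finset.sum_filter_of_ne fun m _ h => left_ne_zero_of_mul h).symm
    _ = ∑ m, Function.extend e (f i) 0 (e m) * Function.extend e (f j) 0 (e m) := by
        refine Finset.sum_congr rfl fun m _ => ?_
        rw [e.injective.extend_apply, e.injective.extend_apply]
        linear_combination (-(U i m * U j m)) * Real.mul_self_sqrt (hB.eigenvalues_nonneg m)
    _ = ∑ l, Function.extend e (f i) 0 l * Function.extend e (f j) 0 l :=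
        Fintype.sum_of_injective e e.injective _ _ hzero fun _ => rfl

/-- Double centering preserves the alternating sum of entries over a principal `2 × 2` block. -/
theorem centering_mul_mul_centering_apply {ι : Type*} [Fintype ι] [DecidableEq ι] (c : ℝ)
    (D : Matrix ι ι ℝ) (i j : ι) :
    let H : Matrix ι ι ℝ := 1 - c • of fun _ _ => 1
    (H * D * H) i i + (H * D * H) j j - (H * D * H) i j - (H * D * H) j i =
      D i i + D j j - D i j - D j i := by
  intro H
  have hleft (M : Matrix ι ι ℝ) (a b : ι) : (H * M) a b = M a b - c * ∑ l, M l b := by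
    simp [H, sub_mul, mul_apply, one_apply, Finset.mul_sum]
  have hright (M : Matrix ι ι ℝ) (a b : ι) : (M * H) a b = M a b - c * ∑ l, M a l := by
    simp [H, mul_sub, mul_apply, one_apply, Finset.mul_sum, mul_comm]
  simp only [hright, hleft]
  ring

/-- Schoenberg-type criterion: if `D` is symmetric with zero diagonal,
`H = I − (1/n)𝟙𝟙ᵀ`, and `B = −(1/2) H D H` is positive semi-definite with
`rank(B) ≤ k`, then there exist points `x₁, …, xₙ ∈ ℝ^k` (the rows of an `n×k`
matrix `X` with `B = X Xᵀ`) such that `D_{ij} = ‖x_i − x_j‖²` for all `i, j`. -/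
theorem schoenberg_embedding (n k : ℕ) (hn : 0 < n)
    (D : Matrix (Fin n) (Fin n) ℝ)
    (hsymm : Dᵀ = D) (hdiag : ∀ i, D i i = 0)
    (H B : Matrix (Fin n) (Fin n) ℝ)
    (hH : H = 1 - (n : ℝ)⁻¹ • Matrix.of (fun _ _ => (1 : ℝ)))
    (hB : B = (-(1 / 2 : ℝ)) • (H * D * H))
    (hpsd : B.PosSemidef) (hrank : B.rank ≤ k) :
    ∃ X : Matrix (Fin n) (Fin k) ℝ,
      B = X * Xᵀ ∧ ∀ i j, D i j = ∑ l, (X i l - X j l) ^ 2 := by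
  obtain ⟨X, hX⟩ := exists_eq_mul_transpose_of_rank_le (κ := Fin k) hpsd (by simpa using hrank)
  refine ⟨X, hX, fun i j => ?_⟩
  have hgram (a b : Fin n) : B a b = ∑ l, X a l * X b l := by
    rw [hX, mul_apply]
    rfl
  have hexpand : ∑ l, (X i l - X j l) ^ 2 = B i i + B j j - B i j - B j i := by
    simp only [hgram, ← Finset.sum_add_distrib, ← Finset.sum_sub_distrib]
    exact Finset.sum_congr rfl fun l _ => by ring
  have hcenter := centering_mul_mul_centering_apply (n : ℝ)⁻¹ D i j
  simp only [← hH, hdiag] at hcenter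
  have hji : D j i = D i j := congrFun₂ hsymm i j
  rw [hexpand, hB]
  simp only [Matrix.smul_apply, smul_eq_mul]
  linarith
end

section
/- Let A be an n×n real symmetric matrix with eigenvalues λ₁ ≥ λ₂ ≥ … ≥ λₙ (counted with multiplicity), and let 1 ≤ k ≤ n. Then the minimum over X ∈ ℝ^{n×k} of ‖A − XXᵀ‖_F² equals Σ_{i=1}^{n} λ_i² − Σ_{i=1}^{k} max(λ_i, 0)², and it is attained at X = U_k diag(max(λ₁,0)^{1/2}, …, max(λ_k,0)^{1/2}), where the columns of U_k are orthonormal eigenvectors of A associated to λ₁, …, λ_k. -/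
open Matrix

/-- A `[0, 1]`-weighted sum of a nonnegative antitone sequence with total weight at most `k`
is bounded by the sum of its first `k` terms. -/
lemma sum_mul_le_sum_castLE_of_antitone {n k : ℕ} (hk : 1 ≤ k) (hkn : k ≤ n) {p d : Fin n → ℝ}
    (hp : Antitone p) (hp0 : ∀ i, 0 ≤ p i) (hd0 : ∀ i, 0 ≤ d i) (hd1 : ∀ i, d i ≤ 1)
    (hd : ∑ i, d i ≤ k) :
    ∑ i, d i * p i ≤ ∑ j : Fin k, p (Fin.castLE hkn j) := by
  obtain ⟨m, rfl⟩ := Nat.exists_eq_add_of_le hkn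
  set t := p ⟨k - 1, by omega⟩ with ht
  have h₁ : ∀ j : Fin k, d (Fin.castAdd m j) * p (Fin.castAdd m j) ≤
      p (Fin.castAdd m j) - t + t * d (Fin.castAdd m j) := fun j => by
    have : t ≤ p (Fin.castAdd m j) := hp (by simp only [Fin.le_def, Fin.val_castAdd]; omega)
    nlinarith [hd1 (Fin.castAdd m j)]
  have h₂ : ∀ j : Fin m, d (Fin.natAdd k j) * p (Fin.natAdd k j) ≤ t * d (Fin.natAdd k j) :=
    fun j => by
      have : p (Fin.natAdd k j) ≤ t := hp (by simp only [Fin.le_def, Fin.val_natAdd]; omega)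
      nlinarith [hd0 (Fin.natAdd k j)]
  have h₃ := Finset.sum_le_sum fun j (_ : j ∈ Finset.univ) => h₁ j
  have h₄ := Finset.sum_le_sum fun j (_ : j ∈ Finset.univ) => h₂ j
  rw [Fin.sum_univ_add] at hd ⊢
  simp only [Finset.sum_add_distrib, Finset.sum_sub_distrib, ← Finset.mul_sum, Finset.sum_const,
    Finset.card_univ, Fintype.card_fin, nsmul_eq_mul] at h₃ h₄
  have h₅ := mul_le_mul_of_nonneg_left hd (hp0 ⟨k - 1, by omega⟩)
  rw [← ht] at h₅
  change _ ≤ ∑ j : Fin k, p (Fin.castAdd m j)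
  linarith

lemma Matrix.sum_sq_eq_trace_mul_transpose {m n : Type*} [Fintype m] [Fintype n]
    (M : Matrix m n ℝ) : ∑ i, ∑ j, M i j ^ 2 = (M * Mᵀ).trace := by
  simp [Matrix.trace, Matrix.mul_apply, sq]

/-- Expansion of the squared Frobenius distance from a symmetric matrix to a Gram matrix. -/
lemma Matrix.IsSymm.sum_sq_sub_mul_transpose {m n : Type*} [Fintype m] [Fintype n]
    {A : Matrix m m ℝ} (hA : A.IsSymm) (X : Matrix m n ℝ) :
    ∑ i, ∑ j, (A i j - (X * Xᵀ) i j) ^ 2 =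
      (A * A).trace - 2 * (Xᵀ * (A * X)).trace + ((Xᵀ * X) * (Xᵀ * X)).trace := by
  have h := (A - X * Xᵀ).sum_sq_eq_trace_mul_transpose
  simp only [Matrix.sub_apply] at h
  have h₁ : (A * (X * Xᵀ)).trace = (Xᵀ * (A * X)).trace := by
    rw [← Matrix.mul_assoc, Matrix.trace_mul_comm]
  have h₂ : (X * Xᵀ * A).trace = (Xᵀ * (A * X)).trace := by
    rw [Matrix.trace_mul_comm, h₁]
  have h₃ : (X * Xᵀ * (X * Xᵀ)).trace = (Xᵀ * X * (Xᵀ * X)).trace := by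
    rw [Matrix.mul_assoc, Matrix.trace_mul_comm]
    simp only [Matrix.mul_assoc]
  rw [h, Matrix.transpose_sub, Matrix.transpose_mul, Matrix.transpose_transpose, hA.eq,
    Matrix.sub_mul, Matrix.mul_sub, Matrix.mul_sub]
  simp only [Matrix.trace_sub, h₁, h₂, h₃]
  ring

/-- Bessel's inequality for the rows of a matrix with orthogonal (possibly zero) columns. -/
lemma Matrix.sum_sq_div_le_one {m n : Type*} [Fintype m] [Fintype n] [DecidableEq n]
    {Y : Matrix m n ℝ} {μ : n → ℝ} (hY : Yᵀ * Y = diagonal μ) (i : m) :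
    ∑ j, Y i j ^ 2 / μ j ≤ 1 := by
  set u : n → ℝ := fun j => Y i j / μ j
  have h₁ : (Y *ᵥ u) i = ∑ j, Y i j ^ 2 / μ j := by
    simp only [Matrix.mulVec, dotProduct, u]
    exact Finset.sum_congr rfl fun j _ => by ring
  have h₂ : (Y *ᵥ u) ⬝ᵥ (Y *ᵥ u) = ∑ j, Y i j ^ 2 / μ j := by
    rw [Matrix.dotProduct_mulVec, ← Matrix.mulVec_transpose, Matrix.mulVec_mulVec, hY]
    simp only [dotProduct, Matrix.mulVec_diagonal, u]
    refine Finset.sum_congr rfl fun j _ => ?_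
    by_cases h : μ j = 0
    · simp [h]
    · field_simp
  have h₃ : (Y *ᵥ u) i ^ 2 ≤ (Y *ᵥ u) ⬝ᵥ (Y *ᵥ u) := by
    rw [sq]
    exact Finset.single_le_sum (f := fun i => (Y *ᵥ u) i * (Y *ᵥ u) i)
      (fun _ _ => mul_self_nonneg _) (Finset.mem_univ i)
  rw [h₂, h₁] at h₃
  nlinarith

/-- Lower bound on the Frobenius distance from a diagonal matrix to a Gram matrix whose factor
has orthogonal columns. -/
lemma sum_sq_max_le_of_transpose_mul_self_eq_diagonal {n k : ℕ} (hk : 1 ≤ k) (hkn : k ≤ n)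
    {lam : Fin n → ℝ} (hlam : Antitone lam) {Y : Matrix (Fin n) (Fin k) ℝ} {μ : Fin k → ℝ}
    (hY : Yᵀ * Y = diagonal μ) :
    -∑ j : Fin k, max (lam (Fin.castLE hkn j)) 0 ^ 2 ≤
      ((Yᵀ * Y) * (Yᵀ * Y)).trace - 2 * (Yᵀ * (diagonal lam * Y)).trace := by
  have hμ : ∀ j, μ j = ∑ i, Y i j ^ 2 := fun j => by
    have := congrFun (congrFun hY j) j
    simpa [Matrix.mul_apply, sq] using this.symm
  have hμ0 : ∀ j, 0 ≤ μ j := fun j => hμ j ▸ Finset.sum_nonneg fun _ _ => sq_nonneg _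
  have hterm : ∀ i j, -(Y i j ^ 2 / μ j * max (lam i) 0 ^ 2) ≤
      Y i j ^ 2 * (μ j - 2 * lam i) := fun i j => by
    rcases (hμ0 j).eq_or_lt with h | h
    · have : Y i j ^ 2 ≤ 0 := by
        rw [h, hμ j]
        exact Finset.single_le_sum (f := fun i => Y i j ^ 2)
          (fun _ _ => sq_nonneg _) (Finset.mem_univ i)
      have h0 : Y i j ^ 2 = 0 := le_antisymm this (sq_nonneg _)
      simp [h0]
    · have h₁ : -(max (lam i) 0 ^ 2) ≤ μ j * (μ j - 2 * lam i) := by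
        nlinarith [sq_nonneg (max (lam i) 0 - μ j), le_max_left (lam i) 0]
      have h₂ : 0 ≤ Y i j ^ 2 / μ j := by positivity
      calc -(Y i j ^ 2 / μ j * max (lam i) 0 ^ 2)
          = Y i j ^ 2 / μ j * -(max (lam i) 0 ^ 2) := by ring
        _ ≤ Y i j ^ 2 / μ j * (μ j * (μ j - 2 * lam i)) := mul_le_mul_of_nonneg_left h₁ h₂
        _ = Y i j ^ 2 * (μ j - 2 * lam i) := by field_simp
  have hexp : ((Yᵀ * Y) * (Yᵀ * Y)).trace - 2 * (Yᵀ * (diagonal lam * Y)).trace =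
      ∑ i, ∑ j, Y i j ^ 2 * (μ j - 2 * lam i) := by
    have h₁ : ((Yᵀ * Y) * (Yᵀ * Y)).trace = ∑ j, μ j * ∑ i, Y i j ^ 2 := by
      simp [hY, Matrix.diagonal_mul_diagonal, Matrix.trace_diagonal, ← hμ]
    have h₂ : (Yᵀ * (diagonal lam * Y)).trace = ∑ j, ∑ i, Y i j * (lam i * Y i j) := by
      simp [Matrix.trace, Matrix.mul_apply, Matrix.diagonal_apply]
    rw [h₁, h₂, Finset.sum_comm (s := (Finset.univ : Finset (Fin n))), Finset.mul_sum, ← Finset.sum_sub_distrib]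
    refine Finset.sum_congr rfl fun j _ => ?_
    rw [Finset.mul_sum, Finset.mul_sum, ← Finset.sum_sub_distrib]
    exact Finset.sum_congr rfl fun i _ => by ring
  have hweight : ∑ i, ∑ j, Y i j ^ 2 / μ j ≤ (k : ℝ) := by
    rw [Finset.sum_comm]
    calc ∑ j, ∑ i, Y i j ^ 2 / μ j ≤ ∑ _j : Fin k, (1 : ℝ) :=
          Finset.sum_le_sum fun j _ => by
            rw [← Finset.sum_div, ← hμ]
            exact div_self_le_one _
      _ = k := by simp
  have hmaj := sum_mul_le_sum_castLE_of_antitone hk hkn (p := fun i => max (lam i) 0 ^ 2)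
    (d := fun i => ∑ j, Y i j ^ 2 / μ j)
    (fun a b hab => pow_le_pow_left₀ (le_max_right _ _) (max_le_max_right 0 (hlam hab)) 2)
    (fun _ => sq_nonneg _)
    (fun i => Finset.sum_nonneg fun j _ => div_nonneg (sq_nonneg _) (hμ0 j))
    (fun i => Matrix.sum_sq_div_le_one hY i) hweight
  rw [hexp]
  refine (neg_le_neg hmaj).trans ?_
  rw [← Finset.sum_neg_distrib]
  refine Finset.sum_le_sum fun i _ => ?_
  rw [Finset.sum_mul, ← Finset.sum_neg_distrib]
  exact Finset.sum_le_sum fun j _ => hterm i j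

/-- Spectral theorem for real symmetric matrices, in transpose form. -/
lemma Matrix.IsHermitian.exists_orthogonal_diagonal {n : Type*} [Fintype n] [DecidableEq n]
    {A : Matrix n n ℝ} (hA : A.IsHermitian) (σ : Equiv.Perm n) :
    ∃ V : Matrix n n ℝ, V * Vᵀ = 1 ∧ A = V * diagonal (hA.eigenvalues ∘ σ) * Vᵀ := by
  set W : Matrix n n ℝ := hA.eigenvectorUnitary.val
  have hW : W * Wᵀ = 1 := by
    have := Unitary.coe_mul_star_self hA.eigenvectorUnitary
    rwa [Unitary.coe_star, Matrix.star_eq_conjTranspose, Matrix.conjTranspose_eq_transpose_of_trivial] at this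
  have hspec : A = W * diagonal hA.eigenvalues * Wᵀ := by
    have := hA.spectral_theorem
    rwa [Unitary.conjStarAlgAut_apply, Matrix.star_eq_conjTranspose,
      Matrix.conjTranspose_eq_transpose_of_trivial] at this
  refine ⟨W.submatrix id σ, ?_, ?_⟩
  · rw [Matrix.transpose_submatrix, Matrix.submatrix_mul_equiv, hW, Matrix.submatrix_id_id]
  · rw [← Matrix.submatrix_diagonal_equiv, Matrix.transpose_submatrix,
      Matrix.submatrix_mul_equiv, Matrix.submatrix_mul_equiv, Matrix.submatrix_id_id, ← hspec]

/-- Classical scaling / best PSD low-rank approximation: for a symmetric matrix `A`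
with eigenvalues `λ₁ ≥ … ≥ λₙ`, the minimum over `X ∈ ℝ^{n×k}` of `‖A − XXᵀ‖_F²`
equals `∑ᵢ λᵢ² − ∑_{i≤k} max(λᵢ,0)²`, and it is attained at
`X = U_k · diag(√max(λ₁,0), …, √max(λ_k,0))`, where the columns of `U_k` are
orthonormal eigenvectors of `A` associated to `λ₁, …, λ_k`. -/
theorem classical_mds_solution (n k : ℕ) (hk1 : 1 ≤ k) (hkn : k ≤ n)
    (A : Matrix (Fin n) (Fin n) ℝ) (hA : A.IsHermitian)
    (lam : Fin n → ℝ) (hanti : Antitone lam)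
    (hperm : ∃ σ : Equiv.Perm (Fin n), lam = hA.eigenvalues ∘ σ)
    (U : Matrix (Fin n) (Fin k) ℝ)
    (hUorth : Uᵀ * U = 1)
    (hUeig : A * U = U * Matrix.diagonal (fun j : Fin k => lam (Fin.castLE hkn j))) :
    IsLeast {t : ℝ | ∃ X : Matrix (Fin n) (Fin k) ℝ,
        (∑ i, ∑ j, (A i j - (X * Xᵀ) i j) ^ 2) = t}
      ((∑ i, lam i ^ 2) - ∑ j : Fin k, max (lam (Fin.castLE hkn j)) 0 ^ 2) ∧
    (∑ i, ∑ j,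
        (A i j -
          ((U * Matrix.diagonal (fun j : Fin k => Real.sqrt (max (lam (Fin.castLE hkn j)) 0))) *
            (U * Matrix.diagonal
              (fun j : Fin k => Real.sqrt (max (lam (Fin.castLE hkn j)) 0)))ᵀ) i j) ^ 2) =
      (∑ i, lam i ^ 2) - ∑ j : Fin k, max (lam (Fin.castLE hkn j)) 0 ^ 2 := by
  obtain ⟨σ, hσ⟩ := hperm
  obtain ⟨V, hV, hAV⟩ := hA.exists_orthogonal_diagonal σ
  rw [← hσ] at hAV
  have hV' : Vᵀ * V = 1 := mul_eq_one_comm.mp hV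
  have hsymm : A.IsSymm := by
    rw [Matrix.IsSymm, ← Matrix.conjTranspose_eq_transpose_of_trivial]
    exact hA
  have htrace : (A * A).trace = ∑ i, lam i ^ 2 := by
    have : A * A = V * (diagonal lam * diagonal lam * Vᵀ) := by
      calc A * A = V * (diagonal lam * ((Vᵀ * V) * (diagonal lam * Vᵀ))) := by
            conv_lhs => rw [hAV]
            simp only [Matrix.mul_assoc]
        _ = V * (diagonal lam * diagonal lam * Vᵀ) := by
            rw [hV', Matrix.one_mul, Matrix.mul_assoc]
    rw [this, Matrix.trace_mul_comm, Matrix.mul_assoc, hV', Matrix.mul_one,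
      Matrix.diagonal_mul_diagonal, Matrix.trace_diagonal]
    exact Finset.sum_congr rfl fun i _ => (sq _).symm
  have hattain := hsymm.sum_sq_sub_mul_transpose
    (U * Matrix.diagonal (fun j : Fin k => Real.sqrt (max (lam (Fin.castLE hkn j)) 0)))
  set r : Fin k → ℝ := fun j => Real.sqrt (max (lam (Fin.castLE hkn j)) 0)
  have hrr : ∀ j, r j * r j = max (lam (Fin.castLE hkn j)) 0 := fun j =>
    Real.mul_self_sqrt (le_max_right _ _)
  have hgram : (U * diagonal r)ᵀ * (U * diagonal r) =
      diagonal fun j => max (lam (Fin.castLE hkn j)) 0 := by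
    rw [Matrix.transpose_mul, Matrix.diagonal_transpose, Matrix.mul_assoc,
      ← Matrix.mul_assoc Uᵀ, hUorth, Matrix.one_mul, Matrix.diagonal_mul_diagonal]
    simp only [hrr]
  have hcross : (U * diagonal r)ᵀ * (A * (U * diagonal r)) =
      diagonal fun j => max (lam (Fin.castLE hkn j)) 0 ^ 2 := by
    rw [← Matrix.mul_assoc A, hUeig, Matrix.transpose_mul, Matrix.diagonal_transpose,
      Matrix.mul_assoc, Matrix.mul_assoc U, ← Matrix.mul_assoc Uᵀ, hUorth, Matrix.one_mul,
      Matrix.diagonal_mul_diagonal, Matrix.diagonal_mul_diagonal]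
    congr 1
    funext j
    have : lam (Fin.castLE hkn j) * max (lam (Fin.castLE hkn j)) 0 =
        max (lam (Fin.castLE hkn j)) 0 ^ 2 := by
      rcases max_cases (lam (Fin.castLE hkn j)) 0 with h | h <;> rw [h.1] <;> ring
    rw [← this, ← hrr]
    ring
  rw [hgram, hcross, htrace, Matrix.diagonal_mul_diagonal, Matrix.trace_diagonal,
    Matrix.trace_diagonal] at hattain
  simp only [← sq] at hattain
  have hval : (∑ i, lam i ^ 2) - 2 * ∑ j : Fin k, max (lam (Fin.castLE hkn j)) 0 ^ 2 +
      ∑ j : Fin k, max (lam (Fin.castLE hkn j)) 0 ^ 2 =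
      (∑ i, lam i ^ 2) - ∑ j : Fin k, max (lam (Fin.castLE hkn j)) 0 ^ 2 := by ring
  rw [hval] at hattain
  refine ⟨⟨⟨_, hattain⟩, ?_⟩, hattain⟩
  rintro _ ⟨X, rfl⟩
  have hX : (Xᵀ * X).IsHermitian := by
    rw [Matrix.IsHermitian, Matrix.conjTranspose_eq_transpose_of_trivial, Matrix.transpose_mul,
      Matrix.transpose_transpose]
  obtain ⟨Q, hQ, hXQ⟩ := hX.exists_orthogonal_diagonal (Equiv.refl _)
  rw [Equiv.coe_refl, Function.comp_id] at hXQ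
  have hQ' : Qᵀ * Q = 1 := mul_eq_one_comm.mp hQ
  have hYY : (Vᵀ * X * Q)ᵀ * (Vᵀ * X * Q) = Qᵀ * (Xᵀ * X) * Q := by
    calc (Vᵀ * X * Q)ᵀ * (Vᵀ * X * Q) = Qᵀ * (Xᵀ * ((V * Vᵀ) * (X * Q))) := by
          simp only [Matrix.transpose_mul, Matrix.transpose_transpose, Matrix.mul_assoc]
      _ = Qᵀ * (Xᵀ * X) * Q := by
          rw [hV, Matrix.one_mul]
          simp only [Matrix.mul_assoc]
  have hY : (Vᵀ * X * Q)ᵀ * (Vᵀ * X * Q) = diagonal hX.eigenvalues := by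
    rw [hYY]
    calc Qᵀ * (Xᵀ * X) * Q
        = (Qᵀ * Q) * diagonal hX.eigenvalues * (Qᵀ * Q) := by
          conv_lhs => rw [hXQ]
          simp only [Matrix.mul_assoc]
      _ = diagonal hX.eigenvalues := by
          rw [hQ', Matrix.one_mul, Matrix.mul_one]
  have hlow := sum_sq_max_le_of_transpose_mul_self_eq_diagonal hk1 hkn hanti hY
  have h₁ : ((Vᵀ * X * Q)ᵀ * (Vᵀ * X * Q) * ((Vᵀ * X * Q)ᵀ * (Vᵀ * X * Q))).trace =
      (Xᵀ * X * (Xᵀ * X)).trace := by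
    rw [hYY]
    calc (Qᵀ * (Xᵀ * X) * Q * (Qᵀ * (Xᵀ * X) * Q)).trace
        = (Qᵀ * ((Xᵀ * X) * ((Q * Qᵀ) * ((Xᵀ * X) * Q)))).trace := by
          simp only [Matrix.mul_assoc]
      _ = (Xᵀ * X * (Xᵀ * X)).trace := by
          rw [hQ, Matrix.one_mul, Matrix.trace_mul_comm, ← Matrix.mul_assoc (Xᵀ * X),
            Matrix.mul_assoc _ Q, hQ, Matrix.mul_one]
  have h₂ : ((Vᵀ * X * Q)ᵀ * (diagonal lam * (Vᵀ * X * Q))).trace = (Xᵀ * (A * X)).trace := by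
    calc ((Vᵀ * X * Q)ᵀ * (diagonal lam * (Vᵀ * X * Q))).trace
        = (Qᵀ * (Xᵀ * ((V * diagonal lam * Vᵀ) * X) * Q)).trace := by
          simp only [Matrix.transpose_mul, Matrix.transpose_transpose, Matrix.mul_assoc]
      _ = (Xᵀ * (A * X)).trace := by
          rw [← hAV, Matrix.trace_mul_comm, Matrix.mul_assoc, hQ, Matrix.mul_one]
  rw [hsymm.sum_sq_sub_mul_transpose, htrace]
  rw [h₁, h₂] at hlow
  linarith
end
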